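/- If m ∈ (0, 1) satisfies ∫₀¹ dx/√((1−x²)(1−m²x²)) = 2·∫₀¹ √((1−m²x²)/(1−x²)) dx, then 0.9089085 < m < 0.9089086. -/

import Mathlib

open intervalIntegral Set
open MeasureTheory (volume)

/-- The Taylor coefficients of `1 / √(1 - y)` at `0`, i.e. `(2n choose n) / 4 ^ n`. -/
def invSqrtCoeff : ℕ → ℚ
  | 0 => 1
  | n + 1 => invSqrtCoeff n * ((2 * n + 1) / (2 * n + 2))

lemma invSqrtCoeff_nonneg (n : ℕ) : 0 ≤ invSqrtCoeff n := by
  induction n with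
  | zero => simp [invSqrtCoeff]
  | succ n ih => simp only [invSqrtCoeff]; positivity

lemma cast_invSqrtCoeff_nonneg (n : ℕ) : (0 : ℝ) ≤ invSqrtCoeff n := by
  exact_mod_cast invSqrtCoeff_nonneg n

lemma cast_invSqrtCoeff_succ (n : ℕ) :
    (invSqrtCoeff (n + 1) : ℝ) = invSqrtCoeff n * ((2 * n + 1) / (2 * n + 2)) := by
  simp [invSqrtCoeff]

/-- The Taylor polynomial of `1 / √(1 - y)` of degree less than `N`. -/
noncomputable def invSqrtTaylor (N : ℕ) (y : ℝ) : ℝ :=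
  ∑ n ∈ Finset.range N, (invSqrtCoeff n : ℝ) * y ^ n

lemma hasDerivAt_sqrt_one_sub {y : ℝ} (hy : y < 1) :
    HasDerivAt (fun y => √(1 - y)) (-(1 / (2 * √(1 - y)))) y := by
  have := ((hasDerivAt_id y).const_sub 1).sqrt (by simp only [id]; linarith)
  exact this.congr_deriv (by simp only [id]; ring)

lemma hasDerivAt_sqrt_mul_invSqrtTaylor (N : ℕ) {y : ℝ} (hy : y < 1) :
    HasDerivAt (fun y => √(1 - y) * invSqrtTaylor N y)
      (-(N * invSqrtCoeff N * y ^ (N - 1) / √(1 - y))) y := by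
  have hs : 0 < √(1 - y) := Real.sqrt_pos.2 (by linarith)
  have hs2 : √(1 - y) ^ 2 = 1 - y := Real.sq_sqrt (by linarith)
  induction N with
  | zero => simpa [invSqrtTaylor] using hasDerivAt_const y (0 : ℝ)
  | succ N ih =>
    have h1 := ih.add ((hasDerivAt_sqrt_one_sub hy).mul
      ((hasDerivAt_pow N y).const_mul (invSqrtCoeff N : ℝ)))
    refine (h1.congr_deriv ?_).congr_of_eventuallyEq (.of_forall fun z => ?_)
    rotate_left
    · simp only [invSqrtTaylor, Finset.sum_range_succ, Pi.add_apply, Pi.mul_apply]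
      ring
    · rw [cast_invSqrtCoeff_succ]
      have hN : (N : ℝ) * y ^ N = N * y ^ (N - 1) * y := by
        rcases N with _ | N
        · simp
        · simp [pow_succ]; ring
      push_cast
      field_simp
      rw [hs2]
      linear_combination (2 * (invSqrtCoeff N : ℝ)) * hN

lemma invSqrtTaylor_le {N : ℕ} {y : ℝ} (hN : N ≠ 0) (hy0 : 0 ≤ y) (hy : y < 1) :
    invSqrtTaylor N y ≤ 1 / √(1 - y) := by
  have hs : 0 < √(1 - y) := Real.sqrt_pos.2 (by linarith)
  have hanti : AntitoneOn (fun y => √(1 - y) * invSqrtTaylor N y) (Icc 0 y) := by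
    refine antitoneOn_of_hasDerivWithinAt_nonpos (convex_Icc 0 y)
      (fun z hz => (hasDerivAt_sqrt_mul_invSqrtTaylor N
        (hz.2.trans_lt hy)).continuousAt.continuousWithinAt)
      (fun z hz => (hasDerivAt_sqrt_mul_invSqrtTaylor N
        ((interior_subset hz).2.trans_lt hy)).hasDerivWithinAt) fun z hz => ?_
    have hz0 := (interior_subset hz).1
    have := cast_invSqrtCoeff_nonneg N
    exact neg_nonpos.2 (by positivity)
  have := hanti (left_mem_Icc.2 hy0) (right_mem_Icc.2 hy0) hy0
  have h0 : invSqrtTaylor N 0 = 1 := by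
    obtain ⟨N, rfl⟩ := Nat.exists_eq_succ_of_ne_zero hN
    simp [invSqrtTaylor, Finset.sum_range_succ', invSqrtCoeff]
  simp only [h0, sub_zero, Real.sqrt_one, mul_one] at this
  rw [le_div_iff₀ hs]
  linarith

lemma le_invSqrtTaylor_add {N : ℕ} {y : ℝ} (hN : N ≠ 0) (hy0 : 0 ≤ y) (hy : y < 1) :
    1 / √(1 - y) ≤ invSqrtTaylor N y + invSqrtCoeff N * y ^ N / (1 - y) := by
  have hs : 0 < √(1 - y) := Real.sqrt_pos.2 (by linarith)
  have hs2 : √(1 - y) ^ 2 = 1 - y := Real.sq_sqrt (by linarith)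
  have hder : ∀ z < 1, HasDerivAt
      (fun y => √(1 - y) * invSqrtTaylor N y + invSqrtCoeff N * y ^ N / √(1 - y))
      (invSqrtCoeff N * z ^ N / (2 * √(1 - z) ^ 3)) z := by
    intro z hz
    have hs : 0 < √(1 - z) := Real.sqrt_pos.2 (by linarith)
    refine ((hasDerivAt_sqrt_mul_invSqrtTaylor N hz).add
      (((hasDerivAt_pow N z).const_mul (invSqrtCoeff N : ℝ)).div
        (hasDerivAt_sqrt_one_sub hz) hs.ne')).congr_deriv ?_
    field_simp
    ring
  have hmono : MonotoneOn
      (fun y => √(1 - y) * invSqrtTaylor N y + invSqrtCoeff N * y ^ N / √(1 - y)) (Icc 0 y) := by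
    refine monotoneOn_of_hasDerivWithinAt_nonneg (convex_Icc 0 y)
      (fun z hz => (hder z (hz.2.trans_lt hy)).continuousAt.continuousWithinAt)
      (fun z hz => (hder z ((interior_subset hz).2.trans_lt hy)).hasDerivWithinAt) fun z hz => ?_
    have hz0 := (interior_subset hz).1
    have := cast_invSqrtCoeff_nonneg N
    positivity
  have := hmono (left_mem_Icc.2 hy0) (right_mem_Icc.2 hy0) hy0
  have h0 : invSqrtTaylor N 0 = 1 := by
    obtain ⟨N, rfl⟩ := Nat.exists_eq_succ_of_ne_zero hN
    simp [invSqrtTaylor, Finset.sum_range_succ', invSqrtCoeff]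
  simp only [h0, sub_zero, Real.sqrt_one, mul_one, zero_pow hN, mul_zero, zero_div,
    add_zero] at this
  rw [div_le_iff₀ hs]
  refine this.trans (le_of_eq ?_)
  have hdiv : √(1 - y) / (1 - y) = 1 / √(1 - y) := Real.sqrt_div_self'
  linear_combination (-(invSqrtCoeff N * y ^ N) : ℝ) * hdiv

/-- On `[0, k]`, the function `(2y - 1) / √(1 - y)` is at most this polynomial. -/
lemma vonKoppenfels_integrand_le {N : ℕ} {k y : ℝ} (hN : N ≠ 0) (hk : 1 / 2 ≤ k) (hk1 : k < 1)
    (hy0 : 0 ≤ y) (hy : y ≤ k) :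
    (2 * y - 1) / √(1 - y) ≤ (2 * y - 1) * invSqrtTaylor N y
      + (2 * k - 1) / (1 - k) * invSqrtCoeff N * y ^ N := by
  have h1 := invSqrtTaylor_le hN hy0 (hy.trans_lt hk1)
  have h2 := le_invSqrtTaylor_add hN hy0 (hy.trans_lt hk1)
  have ha := cast_invSqrtCoeff_nonneg N
  have hR : 1 / √(1 - y) - invSqrtTaylor N y ≤ invSqrtCoeff N * y ^ N / (1 - k) := by
    have : invSqrtCoeff N * y ^ N / (1 - y) ≤ invSqrtCoeff N * y ^ N / (1 - k) := by
      have : 0 < 1 - k := by linarith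
      gcongr
    linarith
  calc (2 * y - 1) / √(1 - y)
      = (2 * y - 1) * invSqrtTaylor N y
        + (2 * y - 1) * (1 / √(1 - y) - invSqrtTaylor N y) := by ring
    _ ≤ (2 * y - 1) * invSqrtTaylor N y
        + (2 * k - 1) * (1 / √(1 - y) - invSqrtTaylor N y) := by
      gcongr
    _ ≤ (2 * y - 1) * invSqrtTaylor N y
        + (2 * k - 1) * (invSqrtCoeff N * y ^ N / (1 - k)) := by
      gcongr
      linarith
    _ = _ := by ring

/-- On `[0, 1)`, the function `(2y - 1) / √(1 - y)` is at least this polynomial. -/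
lemma le_vonKoppenfels_integrand {N : ℕ} {y : ℝ} (hN : N ≠ 0) (hy0 : 0 ≤ y) (hy : y < 1) :
    (2 * y - 1) * invSqrtTaylor N y + -2 * invSqrtCoeff N * y ^ N
      ≤ (2 * y - 1) / √(1 - y) := by
  have h1 := invSqrtTaylor_le hN hy0 hy
  have h2 := le_invSqrtTaylor_add hN hy0 hy
  have ha : 0 ≤ invSqrtCoeff N * y ^ N :=
    mul_nonneg (cast_invSqrtCoeff_nonneg N) (pow_nonneg hy0 N)
  have hsplit : (2 * y - 1) / √(1 - y) = (2 * y - 1) * invSqrtTaylor N y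
      + (2 * y - 1) * (1 / √(1 - y) - invSqrtTaylor N y) := by ring
  rw [hsplit]
  rcases le_total (1 / 2) y with hy2 | hy2
  · have : 0 ≤ (2 * y - 1) * (1 / √(1 - y) - invSqrtTaylor N y) :=
      mul_nonneg (by linarith) (by linarith)
    linarith
  · have h3 : invSqrtCoeff N * y ^ N / (1 - y) ≤ 2 * (invSqrtCoeff N * y ^ N) := by
      rw [div_le_iff₀ (by linarith)]
      nlinarith
    have : (1 - 2 * y) * (1 / √(1 - y) - invSqrtTaylor N y)
        ≤ 1 * (1 / √(1 - y) - invSqrtTaylor N y) := by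
      gcongr
      linarith
    linarith

lemma monotoneOn_vonKoppenfels_integrand :
    MonotoneOn (fun y : ℝ => (2 * y - 1) / √(1 - y)) (Iio 1) := by
  intro y hy z hz hyz
  simp only [mem_Iio] at hy hz
  have key : ∀ x < (1 : ℝ), (2 * x - 1) / √(1 - x) = 1 / √(1 - x) - 2 * √(1 - x) := by
    intro x hx
    have hs : 0 < √(1 - x) := Real.sqrt_pos.2 (by linarith)
    have hs2 : √(1 - x) ^ 2 = 1 - x := Real.sq_sqrt (by linarith)
    field_simp
    linarith
  have hs : 0 < √(1 - z) := Real.sqrt_pos.2 (by linarith)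
  have hle : √(1 - z) ≤ √(1 - y) := Real.sqrt_le_sqrt (by linarith)
  have := one_div_le_one_div_of_le hs hle
  simp only [key y hy, key z hz]
  linarith

lemma one_sub_sq_pos_of_mem_Ioo {x : ℝ} (hx : x ∈ Ioo (0 : ℝ) 1) : 0 < 1 - x ^ 2 := by
  nlinarith [hx.1, hx.2]

lemma intervalIntegrable_arcsin_deriv :
    IntervalIntegrable (fun x : ℝ => 1 / √(1 - x ^ 2)) volume 0 1 := by
  refine intervalIntegrable_deriv_of_nonneg (g := Real.arcsin)
    Real.continuous_arcsin.continuousOn (fun x hx => ?_) fun x _ => by positivity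
  simp only [zero_le_one, inf_of_le_left, sup_of_le_right] at hx
  exact Real.hasDerivAt_arcsin (by linarith [hx.1]) hx.2.ne

lemma intervalIntegrable_arcsin_deriv_mul {f : ℝ → ℝ} (hf : ContinuousOn f (Icc 0 1)) :
    IntervalIntegrable (fun x : ℝ => 1 / √(1 - x ^ 2) * f x) volume 0 1 :=
  intervalIntegrable_arcsin_deriv.mul_continuousOn (by rwa [uIcc_of_le zero_le_one])

lemma integral_arcsin_deriv : ∫ x in (0 : ℝ)..1, 1 / √(1 - x ^ 2) = Real.pi / 2 := by
  rw [integral_eq_sub_of_hasDerivAt_of_le zero_le_one Real.continuous_arcsin.continuousOn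
    (fun x hx => Real.hasDerivAt_arcsin (by linarith [hx.1]) hx.2.ne)
    intervalIntegrable_arcsin_deriv]
  simp

lemma integral_arcsin_deriv_mul_pow (n : ℕ) :
    ∫ x in (0 : ℝ)..1, 1 / √(1 - x ^ 2) * (x ^ 2) ^ n = Real.pi / 2 * invSqrtCoeff n := by
  induction n with
  | zero => simpa [invSqrtCoeff] using integral_arcsin_deriv
  | succ n ih =>
    have hw (n : ℕ) : IntervalIntegrable
        (fun x : ℝ => 1 / √(1 - x ^ 2) * (x ^ 2) ^ n) volume 0 1 :=
      intervalIntegrable_arcsin_deriv_mul (by fun_prop)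
    have hFTC := integral_eq_sub_of_hasDerivAt_of_le (zero_le_one' ℝ)
      (f := fun x : ℝ => x ^ (2 * n + 1) * √(1 - x ^ 2))
      (f' := fun x => (2 * n + 1) * (1 / √(1 - x ^ 2) * (x ^ 2) ^ n)
        - (2 * n + 2) * (1 / √(1 - x ^ 2) * (x ^ 2) ^ (n + 1)))
      (by fun_prop) (fun x hx => ?_) (((hw n).const_mul _).sub ((hw (n + 1)).const_mul _))
    · rw [integral_sub ((hw n).const_mul _) ((hw (n + 1)).const_mul _),
        integral_const_mul, integral_const_mul, ih] at hFTC
      have h1 : (1 : ℝ) ^ (2 * n + 1) * √(1 - 1 ^ 2) - 0 ^ (2 * n + 1) * √(1 - 0 ^ 2) = 0 := by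
        simp
      calc _ = (2 * n + 1) * (Real.pi / 2 * invSqrtCoeff n) / (2 * n + 2) := by
            rw [eq_div_iff (by positivity)]
            linear_combination h1 - hFTC
        _ = _ := by
            rw [cast_invSqrtCoeff_succ]
            ring
    · have hpos := one_sub_sq_pos_of_mem_Ioo hx
      have hs : 0 < √(1 - x ^ 2) := Real.sqrt_pos.2 hpos
      have hs2 : √(1 - x ^ 2) ^ 2 = 1 - x ^ 2 := Real.sq_sqrt hpos.le
      refine ((hasDerivAt_pow (2 * n + 1) x).mul
        (((hasDerivAt_pow 2 x).const_sub 1).sqrt hpos.ne')).congr_deriv ?_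
      push_cast
      field_simp
      rw [hs2]
      ring

/-- The integral over `[0, 1]` of the polynomial bounds for von Koppenfels' integrand against
`1 / √(1 - x ^ 2)`, divided by `π / 2`. -/
def vonKoppenfelsSum (N : ℕ) (k C : ℚ) : ℚ :=
  ∑ n ∈ Finset.range N,
    invSqrtCoeff n * k ^ n * (2 * k * invSqrtCoeff (n + 1) - invSqrtCoeff n)
    + C * k ^ N * invSqrtCoeff N

lemma integral_arcsin_deriv_mul_invSqrtTaylor (N : ℕ) (k C : ℚ) :
    ∫ x in (0 : ℝ)..1, 1 / √(1 - x ^ 2) *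
      ((2 * (k * x ^ 2) - 1) * invSqrtTaylor N (k * x ^ 2) + C * (k * x ^ 2) ^ N)
      = Real.pi / 2 * vonKoppenfelsSum N k C := by
  have hw (n : ℕ) : IntervalIntegrable
      (fun x : ℝ => 1 / √(1 - x ^ 2) * (x ^ 2) ^ n) volume 0 1 :=
    intervalIntegrable_arcsin_deriv_mul (by fun_prop)
  have hterm (n : ℕ) : IntervalIntegrable (fun x : ℝ => (invSqrtCoeff n * k ^ n : ℝ) *
      (2 * k * (1 / √(1 - x ^ 2) * (x ^ 2) ^ (n + 1)) - 1 / √(1 - x ^ 2) * (x ^ 2) ^ n))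
      volume 0 1 :=
    (((hw (n + 1)).const_mul _).sub (hw n)).const_mul _
  calc _ = ∫ x in (0 : ℝ)..1, ((∑ n ∈ Finset.range N, (invSqrtCoeff n * k ^ n : ℝ) *
      (2 * k * (1 / √(1 - x ^ 2) * (x ^ 2) ^ (n + 1)) - 1 / √(1 - x ^ 2) * (x ^ 2) ^ n))
      + C * k ^ N * (1 / √(1 - x ^ 2) * (x ^ 2) ^ N)) := by
        congr 1
        funext x
        rw [invSqrtTaylor, mul_add, Finset.mul_sum, Finset.mul_sum]
        congr 1
        · exact Finset.sum_congr rfl fun n _ => by ring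
        · ring
    _ = _ := by
      rw [integral_add (by
          simpa only [Finset.sum_fn] using
            IntervalIntegrable.sum (Finset.range N) fun n _ => hterm n)
        ((hw N).const_mul _), integral_finsetSum fun n _ => hterm n, integral_const_mul,
        integral_arcsin_deriv_mul_pow, vonKoppenfelsSum]
      push_cast
      rw [mul_add, Finset.mul_sum]
      congr 1
      · refine Finset.sum_congr rfl fun n _ => ?_
        rw [integral_const_mul, integral_sub ((hw (n + 1)).const_mul _) (hw n),
          integral_const_mul, integral_arcsin_deriv_mul_pow, integral_arcsin_deriv_mul_pow]
        ring
      · ring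

lemma vonKoppenfelsSum_lower_neg :
    vonKoppenfelsSum 70 (0.9089085 ^ 2)
      ((2 * 0.9089085 ^ 2 - 1) / (1 - 0.9089085 ^ 2) * invSqrtCoeff 70) < 0 := by
  norm_num [vonKoppenfelsSum, Finset.sum_range_succ, invSqrtCoeff]

lemma vonKoppenfelsSum_upper_pos :
    0 < vonKoppenfelsSum 70 (0.9089086 ^ 2) (-2 * invSqrtCoeff 70) := by
  norm_num [vonKoppenfelsSum, Finset.sum_range_succ, invSqrtCoeff]

lemma continuousOn_vonKoppenfels_integrand {k : ℝ} (hk0 : 0 ≤ k) (hk : k < 1) :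
    ContinuousOn (fun x : ℝ => (2 * (k * x ^ 2) - 1) / √(1 - k * x ^ 2)) (Icc 0 1) := by
  refine ContinuousOn.div (by fun_prop) (by fun_prop) fun x hx => (Real.sqrt_pos.2 ?_).ne'
  have : x ^ 2 ≤ 1 := pow_le_one₀ hx.1 hx.2
  nlinarith

/-- Von Koppenfels' equation as the vanishing of a single integral. -/
lemma integral_vonKoppenfels_eq_zero {m : ℝ} (hm : m ∈ Ioo (0 : ℝ) 1)
    (h : (∫ x in (0 : ℝ)..1, 1 / √((1 - x ^ 2) * (1 - m ^ 2 * x ^ 2)))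
        = 2 * ∫ x in (0 : ℝ)..1, √((1 - m ^ 2 * x ^ 2) / (1 - x ^ 2))) :
    ∫ x in (0 : ℝ)..1, 1 / √(1 - x ^ 2) *
      ((2 * (m ^ 2 * x ^ 2) - 1) / √(1 - m ^ 2 * x ^ 2)) = 0 := by
  have hpos : ∀ x ∈ Icc (0 : ℝ) 1, 0 < 1 - m ^ 2 * x ^ 2 := by
    intro x hx
    have h1 : x ^ 2 ≤ 1 := pow_le_one₀ hx.1 hx.2
    have h2 : m ^ 2 < 1 := pow_lt_one₀ hm.1.le hm.2 two_ne_zero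
    nlinarith [sq_nonneg m]
  have hK : (∫ x in (0 : ℝ)..1, 1 / √((1 - x ^ 2) * (1 - m ^ 2 * x ^ 2)))
      = ∫ x in (0 : ℝ)..1, 1 / √(1 - x ^ 2) * (1 / √(1 - m ^ 2 * x ^ 2)) := by
    refine integral_congr fun x hx => ?_
    rw [uIcc_of_le zero_le_one] at hx
    simp only [Real.sqrt_mul' _ (hpos x hx).le]
    ring
  have hE : (∫ x in (0 : ℝ)..1, √((1 - m ^ 2 * x ^ 2) / (1 - x ^ 2)))
      = ∫ x in (0 : ℝ)..1, 1 / √(1 - x ^ 2) * √(1 - m ^ 2 * x ^ 2) := by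
    refine integral_congr fun x hx => ?_
    rw [uIcc_of_le zero_le_one] at hx
    simp only [Real.sqrt_div (hpos x hx).le]
    ring
  rw [hK, hE, ← integral_const_mul, ← sub_eq_zero,
    ← integral_sub
    (intervalIntegrable_arcsin_deriv_mul (f := fun x => 1 / √(1 - m ^ 2 * x ^ 2))
      (ContinuousOn.div (by fun_prop) (by fun_prop)
        fun x hx => (Real.sqrt_pos.2 (hpos x hx)).ne'))
    ((intervalIntegrable_arcsin_deriv_mul (f := fun x => √(1 - m ^ 2 * x ^ 2))
      (by fun_prop)).const_mul 2)] at h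
  refine (integral_congr fun x hx => ?_).trans h
  rw [uIcc_of_le zero_le_one] at hx
  have hs : 0 < √(1 - m ^ 2 * x ^ 2) := Real.sqrt_pos.2 (hpos x hx)
  have hs2 := Real.sq_sqrt (hpos x hx).le
  have : (2 * (m ^ 2 * x ^ 2) - 1) / √(1 - m ^ 2 * x ^ 2)
      = 1 / √(1 - m ^ 2 * x ^ 2) - 2 * √(1 - m ^ 2 * x ^ 2) := by
    rw [div_eq_iff hs.ne', sub_mul, one_div_mul_cancel hs.ne']
    linarith
  simp only [this]
  ring

lemma lt_of_vonKoppenfelsSum_neg {N : ℕ} {m : ℝ} {q : ℚ} (hN : N ≠ 0) (hm : 0 < m)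
    (hq : 1 / 2 ≤ q ^ 2) (hq0 : 0 < q) (hq1 : q < 1)
    (hsum : vonKoppenfelsSum N (q ^ 2)
      ((2 * q ^ 2 - 1) / (1 - q ^ 2) * invSqrtCoeff N) < 0)
    (h : ∫ x in (0 : ℝ)..1, 1 / √(1 - x ^ 2) *
      ((2 * (m ^ 2 * x ^ 2) - 1) / √(1 - m ^ 2 * x ^ 2)) = 0) : (q : ℝ) < m := by
  by_contra! hle
  have hqr : (1 / 2 : ℝ) ≤ (q : ℝ) ^ 2 := by
    simpa using (Rat.cast_le (K := ℝ)).2 hq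
  have hk1 : (q : ℝ) ^ 2 < 1 := by exact_mod_cast pow_lt_one₀ hq0.le hq1 two_ne_zero
  have hmq : m ^ 2 ≤ (q : ℝ) ^ 2 := pow_le_pow_left₀ hm.le hle 2
  have hmono := integral_mono_on (zero_le_one' ℝ)
    (intervalIntegrable_arcsin_deriv_mul
      (continuousOn_vonKoppenfels_integrand (sq_nonneg m) (hmq.trans_lt hk1)))
    (g := fun x : ℝ => 1 / √(1 - x ^ 2) *
      ((2 * ((q ^ 2 : ℚ) * x ^ 2) - 1) * invSqrtTaylor N ((q ^ 2 : ℚ) * x ^ 2)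
        + ((2 * q ^ 2 - 1) / (1 - q ^ 2) * invSqrtCoeff N : ℚ) * ((q ^ 2 : ℚ) * x ^ 2) ^ N))
    (intervalIntegrable_arcsin_deriv_mul (by unfold invSqrtTaylor; fun_prop))
    fun x hx => by
      have hx2 : x ^ 2 ≤ 1 := pow_le_one₀ hx.1 hx.2
      have hy : (q : ℝ) ^ 2 * x ^ 2 ≤ q ^ 2 := mul_le_of_le_one_right (sq_nonneg _) hx2
      have hmy : m ^ 2 * x ^ 2 ≤ (q : ℝ) ^ 2 * x ^ 2 := by gcongr
      push_cast
      exact mul_le_mul_of_nonneg_left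
        ((monotoneOn_vonKoppenfels_integrand (hmy.trans_lt (hy.trans_lt hk1))
          (hy.trans_lt hk1) hmy).trans
          (vonKoppenfels_integrand_le hN hqr hk1 (by positivity) hy)) (by positivity)
  rw [h, integral_arcsin_deriv_mul_invSqrtTaylor] at hmono
  exact hmono.not_gt (mul_neg_of_pos_of_neg (by positivity) (by exact_mod_cast hsum))

lemma lt_of_vonKoppenfelsSum_pos {N : ℕ} {m : ℝ} {q : ℚ} (hN : N ≠ 0) (hm : m ∈ Ioo (0 : ℝ) 1)
    (hq0 : 0 < q) (hsum : 0 < vonKoppenfelsSum N (q ^ 2) (-2 * invSqrtCoeff N))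
    (h : ∫ x in (0 : ℝ)..1, 1 / √(1 - x ^ 2) *
      ((2 * (m ^ 2 * x ^ 2) - 1) / √(1 - m ^ 2 * x ^ 2)) = 0) : m < q := by
  by_contra! hle
  have hk1 : m ^ 2 < 1 := pow_lt_one₀ hm.1.le hm.2 two_ne_zero
  have hmq : (q : ℝ) ^ 2 ≤ m ^ 2 := pow_le_pow_left₀ (by exact_mod_cast hq0.le) hle 2
  have hmono := integral_mono_on (zero_le_one' ℝ)
    (f := fun x : ℝ => 1 / √(1 - x ^ 2) *
      ((2 * ((q ^ 2 : ℚ) * x ^ 2) - 1) * invSqrtTaylor N ((q ^ 2 : ℚ) * x ^ 2)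
        + (-2 * invSqrtCoeff N : ℚ) * ((q ^ 2 : ℚ) * x ^ 2) ^ N))
    (intervalIntegrable_arcsin_deriv_mul (by unfold invSqrtTaylor; fun_prop))
    (intervalIntegrable_arcsin_deriv_mul
      (continuousOn_vonKoppenfels_integrand (sq_nonneg m) hk1))
    fun x hx => by
      have hx2 : x ^ 2 ≤ 1 := pow_le_one₀ hx.1 hx.2
      have hy : m ^ 2 * x ^ 2 < 1 := (mul_le_of_le_one_right (sq_nonneg _) hx2).trans_lt hk1
      have hmy : (q : ℝ) ^ 2 * x ^ 2 ≤ m ^ 2 * x ^ 2 := by gcongr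
      push_cast
      exact mul_le_mul_of_nonneg_left
        ((le_vonKoppenfels_integrand hN (by positivity) (hmy.trans_lt hy)).trans
          (monotoneOn_vonKoppenfels_integrand (hmy.trans_lt hy) hy hmy)) (by positivity)
  rw [h, integral_arcsin_deriv_mul_invSqrtTaylor] at hmono
  exact hmono.not_gt (mul_pos (by positivity) (by exact_mod_cast hsum))

/-- Any m ∈ (0,1) solving von Koppenfels' equation K(m) = 2E(m) satisfies
0.9089085 < m < 0.9089086. -/
theorem vonKoppenfels_root_bounds (m : ℝ) (hm : m ∈ Set.Ioo (0 : ℝ) 1)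
    (h : (∫ x in (0 : ℝ)..1, 1 / Real.sqrt ((1 - x ^ 2) * (1 - m ^ 2 * x ^ 2)))
        = 2 * ∫ x in (0 : ℝ)..1, Real.sqrt ((1 - m ^ 2 * x ^ 2) / (1 - x ^ 2))) :
    0.9089085 < m ∧ m < 0.9089086 := by
  have h0 := integral_vonKoppenfels_eq_zero hm h
  constructor
  · have := lt_of_vonKoppenfelsSum_neg (q := 0.9089085) (by norm_num) hm.1 (by norm_num)
      (by norm_num) (by norm_num) vonKoppenfelsSum_lower_neg h0
    norm_num at this ⊢
    exact this
  · have := lt_of_vonKoppenfelsSum_pos (q := 0.9089086) (by norm_num) hm (by norm_num)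
      vonKoppenfelsSum_upper_pos h0
    norm_num at this ⊢
    exact this
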